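/- There exists a constant C > 0 such that the following holds. Let q ≥ 2 be real, M a positive integer, c_1, …, c_M real numbers, and set Z(θ) = ∑_{m=1}^M c_m U_m(cos θ). If |Z(θ)| ≤ B for all θ ∈ [0,π], then |∫_0^π Z(θ)² dμ_q(θ) − ∑_{m=1}^M c_m²| ≤ C·B²/q. -/

import Mathlib

open Real Polynomial

theorem integral_cos_int_mul (k : ℤ) :
    ∫ θ in (0:ℝ)..π, Real.cos (k * θ) = if k = 0 then π else 0 := by
  split_ifs with hk
  · simp [hk]
  · have hk' : (k : ℝ) ≠ 0 := Int.cast_ne_zero.mpr hk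
    rw [intervalIntegral.integral_comp_mul_left (fun x => Real.cos x) hk', integral_cos]
    simp [Real.sin_int_mul_pi]

theorem integral_eval_U_mul_eval_U (m n : ℕ) :
    ∫ θ in (0:ℝ)..π, (Polynomial.Chebyshev.U ℝ m).eval (Real.cos θ) *
      (Polynomial.Chebyshev.U ℝ n).eval (Real.cos θ) * ((2 / π) * Real.sin θ ^ 2) =
      if m = n then 1 else 0 := by
  have h (θ : ℝ) : (Polynomial.Chebyshev.U ℝ m).eval (Real.cos θ) *
      (Polynomial.Chebyshev.U ℝ n).eval (Real.cos θ) * ((2 / π) * Real.sin θ ^ 2) =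
      (1 / π) * (Real.cos (((m - n : ℤ) : ℝ) * θ) - Real.cos (((m + n + 2 : ℤ) : ℝ) * θ)) := by
    have hm := Polynomial.Chebyshev.U_real_cos θ m
    have hn := Polynomial.Chebyshev.U_real_cos θ n
    push_cast at hm hn ⊢
    have e₁ : ((m : ℝ) - n) * θ = (m + 1) * θ - (n + 1) * θ := by ring
    have e₂ : ((m : ℝ) + n + 2) * θ = (m + 1) * θ + (n + 1) * θ := by ring
    rw [e₁, e₂, Real.cos_sub, Real.cos_add, ← hm, ← hn]
    ring
  simp_rw [h]
  rw [intervalIntegral.integral_const_mul, intervalIntegral.integral_sub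
    ((by fun_prop : Continuous _).intervalIntegrable _ _)
    ((by fun_prop : Continuous _).intervalIntegrable _ _),
    integral_cos_int_mul, integral_cos_int_mul, if_neg (by omega : (m + n + 2 : ℤ) ≠ 0)]
  by_cases hmn : m = n
  · simp [hmn, Real.pi_ne_zero]
  · simp [hmn, sub_eq_zero]

theorem integral_sq_sum_eval_U (s : Finset ℕ) (c : ℕ → ℝ) :
    ∫ θ in (0:ℝ)..π,
      (∑ m ∈ s, c m * (Polynomial.Chebyshev.U ℝ m).eval (Real.cos θ)) ^ 2 *
        ((2 / π) * Real.sin θ ^ 2) = ∑ m ∈ s, c m ^ 2 := by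
  have h (θ : ℝ) : (∑ m ∈ s, c m * (Polynomial.Chebyshev.U ℝ m).eval (Real.cos θ)) ^ 2 *
        ((2 / π) * Real.sin θ ^ 2) =
      ∑ m ∈ s, ∑ n ∈ s, (c m * c n) * ((Polynomial.Chebyshev.U ℝ m).eval (Real.cos θ) *
      (Polynomial.Chebyshev.U ℝ n).eval (Real.cos θ) * ((2 / π) * Real.sin θ ^ 2)) := by
    rw [sq, Finset.sum_mul_sum, Finset.sum_mul]
    refine Finset.sum_congr rfl fun m _ => ?_
    rw [Finset.sum_mul]
    exact Finset.sum_congr rfl fun n _ => by ring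
  simp_rw [h]
  rw [intervalIntegral.integral_finsetSum
    fun m _ => (by fun_prop : Continuous _).intervalIntegrable _ _]
  refine Finset.sum_congr rfl fun m hm => ?_
  rw [intervalIntegral.integral_finsetSum
    fun n _ => (by fun_prop : Continuous _).intervalIntegrable _ _]
  simp_rw [intervalIntegral.integral_const_mul, integral_eval_U_mul_eval_U]
  simp [hm, sq]

theorem sqrt_add_inv_sq {q : ℝ} (hq : 0 < q) :
    (Real.sqrt q + (Real.sqrt q)⁻¹) ^ 2 = q + 2 + q⁻¹ := by
  have h : Real.sqrt q ≠ 0 := (Real.sqrt_pos.mpr hq).ne'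
  rw [add_sq, inv_pow, Real.sq_sqrt hq.le, mul_assoc, mul_inv_cancel₀ h, mul_one]

theorem div_four_le_sub_four_mul_cos_sq {q : ℝ} (hq : 2 ≤ q) (θ : ℝ) :
    q / 4 ≤ (Real.sqrt q + (Real.sqrt q)⁻¹) ^ 2 - 4 * Real.cos θ ^ 2 := by
  have hq0 : 0 < q := by linarith
  have h : q / 4 ≤ q - 2 + q⁻¹ := by
    rw [← sub_nonneg, show q - 2 + q⁻¹ - q / 4 = (3 * q - 2) * (q - 2) / (4 * q) by
      field_simp; ring]
    exact div_nonneg (mul_nonneg (by linarith) (by linarith)) (by linarith)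
  rw [sqrt_add_inv_sq hq0]
  linarith [Real.cos_sq_le_one θ]

theorem abs_density_sub_one_le {q : ℝ} (hq : 2 ≤ q) (θ : ℝ) :
    |(q + 1) / ((Real.sqrt q + (Real.sqrt q)⁻¹) ^ 2 - 4 * Real.cos θ ^ 2) - 1| ≤ 16 / q := by
  have hq0 : 0 < q := by linarith
  have hD := div_four_le_sub_four_mul_cos_sq hq θ
  have hD0 : 0 < (Real.sqrt q + (Real.sqrt q)⁻¹) ^ 2 - 4 * Real.cos θ ^ 2 := by linarith
  have hnum : |q + 1 - ((Real.sqrt q + (Real.sqrt q)⁻¹) ^ 2 - 4 * Real.cos θ ^ 2)| ≤ 4 := by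
    have h₁ : q⁻¹ ≤ 1 := inv_le_one_of_one_le₀ (by linarith)
    have h₂ : 0 < q⁻¹ := inv_pos.mpr hq0
    rw [sqrt_add_inv_sq hq0, abs_le]
    constructor <;> linarith [Real.cos_sq_le_one θ, sq_nonneg (Real.cos θ)]
  rw [div_sub_one hD0.ne', abs_div, abs_of_pos hD0]
  calc _ ≤ 4 / (q / 4) := by gcongr
    _ = 16 / q := by field_simp; norm_num

/-- There is a constant `C > 0` such that the following holds: for real `q ≥ 2`, a
positive integer `M` and reals `c_1, …, c_M`, if `Z(θ) = ∑_{m=1}^M c_m U_m(cos θ)`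
satisfies `|Z(θ)| ≤ B` on `[0,π]`, then the integral of `Z²` against the measure `μ_q`
(density `[(q + 1)/((q^{1/2} + q^{−1/2})² − 4cos²θ)] · (2/π) sin²θ`) is within
`C·B²/q` of `∑_{m=1}^M c_m²`. -/
theorem integral_sq_chebyshev_sum_mu_q :
    ∃ C : ℝ, 0 < C ∧ ∀ q : ℝ, 2 ≤ q → ∀ M : ℕ, 0 < M → ∀ c : ℕ → ℝ, ∀ B : ℝ,
      (∀ θ ∈ Set.Icc (0:ℝ) π,
        |∑ m ∈ Finset.Icc 1 M, c m * (Polynomial.Chebyshev.U ℝ m).eval (Real.cos θ)|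
          ≤ B) →
      |(∫ θ in (0:ℝ)..π,
          (∑ m ∈ Finset.Icc 1 M, c m * (Polynomial.Chebyshev.U ℝ m).eval (Real.cos θ)) ^ 2 *
            ((q + 1) / ((Real.sqrt q + (Real.sqrt q)⁻¹) ^ 2 - 4 * Real.cos θ ^ 2)) *
            ((2 / π) * Real.sin θ ^ 2)) -
        ∑ m ∈ Finset.Icc 1 M, c m ^ 2| ≤ C * B ^ 2 / q := by
  refine ⟨32, by norm_num, fun q hq M _ c B hB => ?_⟩
  have hq0 : 0 < q := by linarith
  have hD (θ : ℝ) : (Real.sqrt q + (Real.sqrt q)⁻¹) ^ 2 - 4 * Real.cos θ ^ 2 ≠ 0 :=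
    (lt_of_lt_of_le (by linarith) (div_four_le_sub_four_mul_cos_sq hq θ)).ne'
  rw [← integral_sq_sum_eval_U, ← intervalIntegral.integral_sub
    (Continuous.intervalIntegrable (by fun_prop (disch := exact hD _)) _ _)
    (Continuous.intervalIntegrable (by fun_prop) _ _), ← Real.norm_eq_abs]
  refine (intervalIntegral.norm_integral_le_of_norm_le_const
    (C := B ^ 2 * (16 / q) * (2 / π)) fun θ hθ => ?_).trans_eq ?_
  · rw [Set.uIoc_of_le Real.pi_pos.le] at hθ
    have hZ := hB θ ⟨hθ.1.le, hθ.2⟩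
    have hd := abs_density_sub_one_le hq θ
    have hs := Real.sin_sq_le_one θ
    have hZ2 := sq_le_sq' (neg_le_of_abs_le hZ) (le_of_abs_le hZ)
    generalize (∑ m ∈ Finset.Icc 1 M, c m * (Polynomial.Chebyshev.U ℝ m).eval (Real.cos θ)) = Z
      at *
    generalize (q + 1) / ((Real.sqrt q + (Real.sqrt q)⁻¹) ^ 2 - 4 * Real.cos θ ^ 2) = d at *
    rw [Real.norm_eq_abs, show Z ^ 2 * d * (2 / π * Real.sin θ ^ 2) -
      Z ^ 2 * (2 / π * Real.sin θ ^ 2) = Z ^ 2 * (d - 1) * (2 / π * Real.sin θ ^ 2) by ring,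
      abs_mul, abs_mul, abs_of_nonneg (sq_nonneg Z),
      abs_of_nonneg (by positivity : 0 ≤ 2 / π * Real.sin θ ^ 2)]
    gcongr
    exact mul_le_of_le_one_right (by positivity) hs
  · rw [sub_zero, abs_of_pos Real.pi_pos]
    field_simp
    ring
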